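/- Let A be a p-group acting on a p'-group G, C = C_G(A), C ≤ H ≤ G A-invariant, θ ∈ Irr_A(G), and let φ = f_A(θ) ∈ Irr_A(H) be its correspondent. Then [θ_C, θ*] ≡ [θ_H, φ]·[φ_C, θ*] (mod p), where θ* ∈ Irr(C) is the A-Glauberman correspondent of θ (and of φ). -/

import Mathlib

attribute [local instance] Classical.propDecidable

/-- The usual inner product of class functions/characters on a finite group. -/
noncomputable def innerChar (G : Type*) [Group G] [Fintype G] (α β : G → ℂ) : ℂ :=
  (Fintype.card G : ℂ)⁻¹ * ∑ g : G, α g * (starRingEnd ℂ) (β g)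

/-- `χ : G → ℂ` is the character of some finite-dimensional complex representation. -/
def IsChar (G : Type) [Group G] [Fintype G] (χ : G → ℂ) : Prop :=
  ∃ V : FDRep ℂ G, FDRep.character V = χ

/-- `χ` is an irreducible complex character of `G`. -/
def IsIrrChar (G : Type) [Group G] [Fintype G] (χ : G → ℂ) : Prop :=
  IsChar G χ ∧ innerChar G χ χ = 1

theorem isIntegral_trace_of_pow_eq_one {V : Type*} [AddCommGroup V] [Module ℂ V]
    [FiniteDimensional ℂ V] (f : Module.End ℂ V) {n : ℕ} (hn : 0 < n) (hf : f ^ n = 1) :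
    IsIntegral ℤ (LinearMap.trace ℂ V f) := by
  rw [Module.End.trace_eq_sum_roots_charpoly_of_splits (IsAlgClosed.splits _)]
  refine IsIntegral.multiset_sum fun μ hμ => ?_
  have hev : f.HasEigenvalue μ :=
    (f.hasEigenvalue_iff_isRoot_charpoly μ).2 (Polynomial.isRoot_of_mem_roots hμ)
  obtain ⟨v, hv⟩ := hev.exists_hasEigenvector
  have h1 := hv.pow_apply n
  rw [hf, Module.End.one_apply] at h1
  have h2 : μ ^ n = 1 := by
    have h3 : (μ ^ n - 1) • v = 0 := by rw [sub_smul, ← h1, one_smul, sub_self]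
    exact sub_eq_zero.1 ((smul_eq_zero.1 h3).resolve_right hv.2)
  exact IsIntegral.of_pow hn (h2 ▸ isIntegral_one)

theorem IsChar.isIntegral {G : Type} [Group G] [Fintype G] {χ : G → ℂ} (h : IsChar G χ) (g : G) :
    IsIntegral ℤ (χ g) := by
  obtain ⟨V, rfl⟩ := h
  exact isIntegral_trace_of_pow_eq_one (V.ρ g) Fintype.card_pos
    (by rw [← map_pow, pow_card_eq_one, map_one])

theorem IsChar.mul_comm {G : Type} [Group G] [Fintype G] {χ : G → ℂ} (h : IsChar G χ) (x y : G) :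
    χ (x * y) = χ (y * x) := by
  obtain ⟨V, rfl⟩ := h
  exact V.char_mul_comm y x

theorem IsChar.comp {G K : Type} [Group G] [Fintype G] [Group K] [Fintype K] {χ : G → ℂ}
    (h : IsChar G χ) (ι : K →* G) : IsChar K (fun k => χ (ι k)) := by
  obtain ⟨V, rfl⟩ := h
  exact ⟨FDRep.of (V.ρ.comp ι), rfl⟩

open scoped ComplexOrder in
/-- Traces on a finite group of complex matrices satisfy `conj (tr M g) = tr (M g⁻¹)`. -/
theorem star_trace_eq_trace_inv {G n : Type*} [Group G] [Fintype G] [Fintype n] [DecidableEq n]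
    (M : G →* Matrix n n ℂ) (g : G) : star (M g).trace = (M g⁻¹).trace := by
  set P : Matrix n n ℂ := ∑ x : G, (M x).conjTranspose * M x with hP
  have hpd : P.PosDef := by
    have h1 : P = 1 + ∑ x ∈ Finset.univ.erase (1 : G), (M x).conjTranspose * M x := by
      rw [hP, ← Finset.add_sum_erase _ _ (Finset.mem_univ (1 : G))]
      simp
    rw [h1]
    exact Matrix.PosDef.one.add_posSemidef
      (Matrix.posSemidef_sum _ fun x _ => Matrix.posSemidef_conjTranspose_mul_self _)
  have hinv : (M g).conjTranspose * P * M g = P := by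
    rw [hP, Finset.mul_sum, Finset.sum_mul]
    refine Fintype.sum_equiv (Equiv.mulRight g) _ _ fun x => ?_
    simp [Matrix.mul_assoc]
  have hu : IsUnit P.det := (Matrix.isUnit_iff_isUnit_det _).1 hpd.isUnit
  have h2 : M g * M g⁻¹ = 1 := by rw [← map_mul, mul_inv_cancel, map_one]
  have h3 : (M g).conjTranspose = P * M g⁻¹ * P⁻¹ := by
    calc (M g).conjTranspose
        = (M g).conjTranspose * P * (M g * M g⁻¹) * P⁻¹ := by
          rw [h2, Matrix.mul_one, Matrix.mul_assoc, Matrix.mul_nonsing_inv _ hu, Matrix.mul_one]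
      _ = P * M g⁻¹ * P⁻¹ := by rw [← Matrix.mul_assoc, hinv]
  rw [← Matrix.trace_conjTranspose, h3, Matrix.trace_mul_comm, ← Matrix.mul_assoc,
    Matrix.nonsing_inv_mul _ hu, Matrix.one_mul]

theorem IsChar.conj {G : Type} [Group G] [Fintype G] {χ : G → ℂ} (h : IsChar G χ) (g : G) :
    (starRingEnd ℂ) (χ g) = χ g⁻¹ := by
  obtain ⟨V, rfl⟩ := h
  let b := Module.finBasis ℂ V
  have key := star_trace_eq_trace_inv
    ((MonoidHomClass.toMonoidHom (LinearMap.toMatrixAlgEquiv b)).comp V.ρ) g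
  have h1 : ∀ x, (((MonoidHomClass.toMonoidHom (LinearMap.toMatrixAlgEquiv b)).comp V.ρ) x).trace = V.character x :=
    fun x => (LinearMap.trace_eq_matrix_trace ℂ b (V.ρ x)).symm
  rw [h1, h1] at key
  exact key

theorem innerChar_eq {G : Type} [Group G] [Fintype G] (χ : G → ℂ) {ψ : G → ℂ}
    (hψ : IsChar G ψ) : innerChar G χ ψ = (Fintype.card G : ℂ)⁻¹ * ∑ g, χ g * ψ g⁻¹ := by
  simp only [innerChar, hψ.conj]

theorem card_mul_innerChar {G : Type} [Group G] [Fintype G] (χ : G → ℂ) {ψ : G → ℂ}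
    (hψ : IsChar G ψ) : (Fintype.card G : ℂ) * innerChar G χ ψ = ∑ g, χ g * ψ g⁻¹ := by
  rw [innerChar_eq χ hψ, mul_inv_cancel_left₀]
  exact Nat.cast_ne_zero.2 Fintype.card_ne_zero

theorem innerChar_eq_natCast {G : Type} [Group G] [Fintype G] {χ ψ : G → ℂ}
    (hχ : IsChar G χ) (hψ : IsChar G ψ) : ∃ m : ℕ, innerChar G χ ψ = m := by
  rw [innerChar_eq χ hψ]
  obtain ⟨V, rfl⟩ := hχ
  obtain ⟨W, rfl⟩ := hψ
  have : Invertible (Nat.card G : ℂ) := invertibleOfNonzero (NeZero.ne _)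
  exact ⟨_, by rw [← FDRep.scalar_product_char_eq_finrank_equivariant W V, Nat.card_eq_fintype_card]⟩

theorem IsIrrChar.innerChar_eq_ite {G : Type} [Group G] [Fintype G] {χ ψ : G → ℂ}
    (hχ : IsIrrChar G χ) (hψ : IsIrrChar G ψ) : innerChar G χ ψ = if χ = ψ then 1 else 0 := by
  split_ifs with h
  · rw [← h]; exact hχ.2
  have hs : ∀ V : FDRep ℂ G, innerChar G V.character V.character = 1 →
      CategoryTheory.Simple V := by
    intro V hV
    rw [FDRep.simple_iff_char_is_norm_one, ← card_mul_innerChar _ ⟨V, rfl⟩, hV, mul_one,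
      Nat.card_eq_fintype_card]
  obtain ⟨⟨V, rfl⟩, hV⟩ := hχ
  obtain ⟨⟨W, rfl⟩, hW⟩ := hψ
  have := hs V hV
  have := hs W hW
  have : Invertible (Nat.card G : ℂ) := invertibleOfNonzero (NeZero.ne _)
  have key := FDRep.char_orthonormal V W
  rw [if_neg fun ⟨i⟩ => h (FDRep.char_iso i), Nat.card_eq_fintype_card] at key
  rw [innerChar_eq _ ⟨W, rfl⟩, key]

theorem IsIrrChar.exists_rep {G : Type} [Group G] [Fintype G] {χ : G → ℂ} (hχ : IsIrrChar G χ) :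
    ∃ V : FDRep ℂ G, V.character = χ ∧ ∀ T : V →ₗ[ℂ] V, (∀ g, T ∘ₗ V.ρ g = V.ρ g ∘ₗ T) →
      ∃ c : ℂ, T = c • LinearMap.id := by
  obtain ⟨⟨V, rfl⟩, hV⟩ := hχ
  refine ⟨V, rfl, fun T hT => ?_⟩
  have : Invertible (Nat.card G : ℂ) := invertibleOfNonzero (NeZero.ne _)
  have key := Representation.card_inv_mul_sum_char_mul_char_eq_finrank V.ρ V.ρ
  rw [innerChar_eq _ ⟨V, rfl⟩] at hV
  rw [Nat.card_eq_fintype_card] at key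
  have h1 : Module.finrank ℂ (Representation.IntertwiningMap V.ρ V.ρ) = 1 := by
    exact_mod_cast key.symm.trans hV
  have hne : (1 : Representation.IntertwiningMap V.ρ V.ρ) ≠ 0 := by
    have : Nontrivial (Representation.IntertwiningMap V.ρ V.ρ) :=
      Module.nontrivial_of_finrank_pos (R := ℂ) (by omega)
    exact one_ne_zero
  obtain ⟨c, hc⟩ := (finrank_eq_one_iff_of_nonzero' _ hne).1 h1 ⟨T, fun g => by exact hT g⟩
  exact ⟨c, (congrArg Representation.IntertwiningMap.toLinearMap hc).symm⟩

theorem IsIrrChar.apply_one_ne_zero {G : Type} [Group G] [Fintype G] {χ : G → ℂ}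
    (hχ : IsIrrChar G χ) : χ 1 ≠ 0 := by
  intro h0
  obtain ⟨⟨V, rfl⟩, hV⟩ := hχ
  rw [FDRep.char_one, Nat.cast_eq_zero] at h0
  have : Subsingleton V := Module.finrank_zero_iff.1 h0
  have hz : ∀ g, V.character g = 0 := fun g => by
    change LinearMap.trace ℂ V (V.ρ g) = 0
    rw [Subsingleton.elim (V.ρ g) 0, map_zero]
  simp [innerChar, hz] at hV

theorem IsIrrChar.sum_mul_conj {G : Type} [Group G] [Fintype G] {χ : G → ℂ}
    (hχ : IsIrrChar G χ) (x y : G) :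
    χ 1 * ∑ g, χ (x * (g * y * g⁻¹)) = Fintype.card G * (χ x * χ y) := by
  obtain ⟨V, rfl, hV⟩ := hχ.exists_rep
  obtain ⟨c, hc⟩ := hV (∑ g, V.ρ (g * y * g⁻¹)) fun h => by
    change (∑ g, V.ρ (g * y * g⁻¹)) * V.ρ h = V.ρ h * ∑ g, V.ρ (g * y * g⁻¹)
    rw [Finset.sum_mul, Finset.mul_sum]
    refine (Fintype.sum_equiv (Equiv.mulLeft h) _ _ fun g => ?_).symm
    simp [← map_mul, mul_assoc]
  have h1 : ∑ g, V.character (x * (g * y * g⁻¹)) = c * V.character x := by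
    have := congrArg (fun T => LinearMap.trace ℂ V (V.ρ x * T)) hc
    simp only [Finset.mul_sum, map_sum, ← map_mul] at this
    refine this.trans ?_
    rw [mul_smul_comm, map_smul, smul_eq_mul]
    rfl
  have h2 : Fintype.card G * V.character y = c * V.character 1 := by
    have := congrArg (LinearMap.trace ℂ V) hc
    rw [map_sum, map_smul, LinearMap.trace_id, ← FDRep.char_one, smul_eq_mul] at this
    rw [← this]
    refine Eq.trans ?_ (Finset.sum_congr rfl fun g _ => (V.char_conj y g).symm)
    simp
  rw [h1]
  linear_combination (-V.character x) * h2

theorem IsIrrChar.sum_mul_inv_mul {G : Type} [Group G] [Fintype G] {χ ψ : G → ℂ}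
    (hχ : IsIrrChar G χ) (hψ : IsIrrChar G ψ) (hne : χ ≠ ψ) (z : G) :
    ∑ g, χ g * ψ (g⁻¹ * z) = 0 := by
  have horth := hχ.innerChar_eq_ite hψ
  have h0 := hψ.apply_one_ne_zero
  have hsum := card_mul_innerChar χ hψ.1
  rw [horth, if_neg hne, mul_zero] at hsum
  obtain ⟨V, rfl, hV⟩ := hψ.exists_rep
  obtain ⟨c, hc⟩ := hV (∑ g, χ g • V.ρ g⁻¹) fun h => by
    change (∑ g, χ g • V.ρ g⁻¹) * V.ρ h = V.ρ h * ∑ g, χ g • V.ρ g⁻¹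
    rw [Finset.sum_mul, Finset.mul_sum]
    refine Fintype.sum_equiv (MulAut.conj h⁻¹).toEquiv _ _ fun g => ?_
    have h1 : χ (h⁻¹ * (g * h)) = χ g := by rw [hχ.1.mul_comm, mul_assoc, mul_inv_cancel, mul_one]
    simp [← map_mul, mul_assoc, h1]
  have hc0 : c = 0 := by
    have := congrArg (LinearMap.trace ℂ V) hc
    simp only [map_sum, map_smul, LinearMap.trace_id, smul_eq_mul] at this
    rw [← FDRep.char_one] at this
    have h3 : c * V.character 1 = 0 := by rw [← this, hsum]; rfl
    exact (mul_eq_zero.1 h3).resolve_right h0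
  have := congrArg (fun T => LinearMap.trace ℂ V (T * V.ρ z)) hc
  simp only [hc0, zero_smul, zero_mul, map_zero, Finset.sum_mul, map_sum, smul_mul_assoc,
    map_smul, ← map_mul, smul_eq_mul] at this
  exact this

theorem character_eq_add_of_isCompl {G V : Type*} [Group G] [AddCommGroup V] [Module ℂ V]
    [FiniteDimensional ℂ V] {ρ : Representation ℂ G V} {σ τ : Subrepresentation ρ}
    (h : IsCompl σ.toSubmodule τ.toSubmodule) (g : G) :
    ρ.character g = σ.toRepresentation.character g + τ.toRepresentation.character g := by
  let N : Bool → Submodule ℂ V := fun b => bif b then σ.toSubmodule else τ.toSubmodule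
  have hN : DirectSum.IsInternal N :=
    (DirectSum.isInternal_submodule_iff_isCompl N (i := true) (j := false) (by simp)
      (by ext b; cases b <;> simp)).2 h
  have hmaps : ∀ b, Set.MapsTo (ρ g) (N b) (N b) := by
    rintro (_ | _)
    · exact fun v hv => τ.apply_mem_toSubmodule g hv
    · exact fun v hv => σ.apply_mem_toSubmodule g hv
  have key := LinearMap.trace_eq_sum_trace_restrict hN hmaps
  rw [Fintype.sum_bool] at key
  exact key

theorem Representation.exists_multiset_isIrrChar {G : Type} [Group G] [Fintype G] (n : ℕ) :
    ∀ (V : Type) [AddCommGroup V] [Module ℂ V] [FiniteDimensional ℂ V]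
      (ρ : Representation ℂ G V), Module.finrank ℂ V = n →
      ∃ s : Multiset (G → ℂ), (∀ ψ ∈ s, IsIrrChar G ψ) ∧ ρ.character = s.sum := by
  induction n using Nat.strong_induction_on with
  | _ n ih =>
    intro V _ _ _ ρ hn
    have hinv : Invertible (Nat.card G : ℂ) := invertibleOfNonzero (NeZero.ne _)
    by_cases hirr : ρ.IsIrreducible
    · refine ⟨{ρ.character}, fun ψ hψ => ?_, by simp⟩
      rw [Multiset.mem_singleton.1 hψ]
      have hc : IsChar G ρ.character := ⟨FDRep.of ρ, rfl⟩
      refine ⟨hc, ?_⟩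
      have key := Representation.char_orthonormal ρ ρ
      rw [if_pos ⟨Representation.Equiv.refl ρ⟩, Nat.card_eq_fintype_card] at key
      rw [innerChar_eq _ hc, key]
    by_cases hV : Subsingleton V
    · refine ⟨0, by simp, ?_⟩
      ext g
      rw [Representation.character, Subsingleton.elim (ρ g) 0, map_zero]
      rfl
    have hnt : Nontrivial (Subrepresentation ρ) := by
      refine ⟨⊥, ⊤, fun h => hV ?_⟩
      have h2 : (⊥ : Submodule ℂ V) = ⊤ := congrArg Subrepresentation.toSubmodule h
      exact (Submodule.subsingleton_iff ℂ).1 (subsingleton_of_bot_eq_top h2)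
    obtain ⟨σ, hσb, hσt⟩ : ∃ σ : Subrepresentation ρ, σ ≠ ⊥ ∧ σ ≠ ⊤ := by
      by_contra! hcon
      exact hirr ⟨fun σ => or_iff_not_imp_left.2 (hcon σ)⟩
    have hneZ : NeZero (Nat.card G : ℂ) := ⟨NeZero.ne _⟩
    obtain ⟨τ, hτ⟩ := exists_isCompl σ
    have hcompl : IsCompl σ.toSubmodule τ.toSubmodule := by
      constructor
      · rw [disjoint_iff]
        exact congrArg Subrepresentation.toSubmodule (disjoint_iff.1 hτ.1)
      · rw [codisjoint_iff]
        exact congrArg Subrepresentation.toSubmodule (codisjoint_iff.1 hτ.2)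
    have hdim := Submodule.finrank_add_eq_of_isCompl hcompl
    have hσ0 : σ.toSubmodule ≠ ⊥ := fun h =>
      hσb (Subrepresentation.toSubmodule_injective h)
    have hτ0 : τ.toSubmodule ≠ ⊥ := fun h => by
      refine hσt (Subrepresentation.toSubmodule_injective ?_)
      have h2 := codisjoint_iff.1 hcompl.2
      rwa [h, sup_bot_eq] at h2
    have h1 : 0 < Module.finrank ℂ σ.toSubmodule :=
      Nat.pos_of_ne_zero fun h => hσ0 (Submodule.finrank_eq_zero.1 h)
    have h2 : 0 < Module.finrank ℂ τ.toSubmodule :=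
      Nat.pos_of_ne_zero fun h => hτ0 (Submodule.finrank_eq_zero.1 h)
    obtain ⟨s, hs, hs'⟩ := ih _ (by omega) σ.toSubmodule σ.toRepresentation rfl
    obtain ⟨t, ht, ht'⟩ := ih _ (by omega) τ.toSubmodule τ.toRepresentation rfl
    refine ⟨s + t, fun ψ hψ => (Multiset.mem_add.1 hψ).elim (hs ψ) (ht ψ), ?_⟩
    ext g
    rw [Multiset.sum_add, ← hs', ← ht', Pi.add_apply, character_eq_add_of_isCompl hcompl]

theorem IsChar.exists_multiset_isIrrChar {G : Type} [Group G] [Fintype G] {χ : G → ℂ}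
    (hχ : IsChar G χ) :
    ∃ s : Multiset (G → ℂ), (∀ ψ ∈ s, IsIrrChar G ψ) ∧ χ = s.sum := by
  obtain ⟨V, rfl⟩ := hχ
  exact Representation.exists_multiset_isIrrChar _ V V.ρ rfl

theorem innerChar_sum_mul {G ι : Type*} [Group G] [Fintype G] (S : Finset ι) (m : ι → ℂ)
    (f : ι → G → ℂ) (ψ : G → ℂ) :
    innerChar G (fun g => ∑ i ∈ S, m i * f i g) ψ = ∑ i ∈ S, m i * innerChar G (f i) ψ := by
  simp only [innerChar, Finset.mul_sum, Finset.sum_mul]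
  rw [Finset.sum_comm]
  exact Finset.sum_congr rfl fun i _ => Finset.sum_congr rfl fun g _ => by ring

/-- A character is the sum of its irreducible constituents with multiplicities. -/
theorem IsChar.exists_eq_sum {G : Type} [Group G] [Fintype G] {χ : G → ℂ} (hχ : IsChar G χ) :
    ∃ S : Finset (G → ℂ), (∀ ψ, ψ ∈ S ↔ IsIrrChar G ψ ∧ innerChar G χ ψ ≠ 0) ∧
      χ = fun g => ∑ ψ ∈ S, innerChar G χ ψ * ψ g := by
  obtain ⟨s, hs, hsum⟩ := hχ.exists_multiset_isIrrChar
  have h1 : χ = fun g => ∑ ψ ∈ s.toFinset, (s.count ψ : ℂ) * ψ g := by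
    ext g
    rw [hsum, Finset.sum_multiset_count, Finset.sum_apply]
    exact Finset.sum_congr rfl fun ψ _ => by simp
  have h2 : ∀ ψ, IsIrrChar G ψ → innerChar G χ ψ = s.count ψ := by
    intro ψ hψ
    have h3 : ∀ ψ' ∈ s.toFinset, (s.count ψ' : ℂ) * innerChar G ψ' ψ =
        if ψ' = ψ then (s.count ψ : ℂ) else 0 := by
      intro ψ' hψ'
      rw [(hs ψ' (Multiset.mem_toFinset.1 hψ')).innerChar_eq_ite hψ]
      split_ifs with h
      · rw [h, mul_one]
      · rw [mul_zero]
    conv_lhs => rw [h1]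
    rw [innerChar_sum_mul, Finset.sum_congr rfl h3, Finset.sum_ite_eq']
    split_ifs with h
    · rfl
    · rw [Multiset.mem_toFinset, ← Multiset.count_eq_zero] at h
      rw [h, Nat.cast_zero]
  refine ⟨s.toFinset, fun ψ => ⟨fun h => ?_, fun ⟨hi, h⟩ => ?_⟩, ?_⟩
  · rw [Multiset.mem_toFinset] at h
    refine ⟨hs ψ h, ?_⟩
    rw [h2 ψ (hs ψ h)]
    exact Nat.cast_ne_zero.2 (Multiset.count_ne_zero.2 h)
  · rw [h2 ψ hi] at h
    exact Multiset.mem_toFinset.2 (Multiset.count_ne_zero.1 (Nat.cast_ne_zero.1 h))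
  · conv_lhs => rw [h1]
    ext g
    exact Finset.sum_congr rfl fun ψ hψ => by
      rw [h2 ψ (hs ψ (Multiset.mem_toFinset.1 hψ))]

/-- The algebraic integers in `ℂ` divisible by `n`. -/
noncomputable def integralMultiples (n : ℕ) : Submodule (integralClosure ℤ ℂ) ℂ :=
  Submodule.span _ {(n : ℂ)}

theorem mem_integralMultiples {n : ℕ} {z : ℂ} :
    z ∈ integralMultiples n ↔ ∃ r, IsIntegral ℤ r ∧ r * n = z := by
  rw [integralMultiples, Submodule.mem_span_singleton]
  exact ⟨fun ⟨a, ha⟩ => ⟨a, a.2, ha⟩, fun ⟨r, hr, h⟩ => ⟨⟨r, hr⟩, h⟩⟩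

theorem mul_mem_integralMultiples {n : ℕ} {z w : ℂ} (hw : IsIntegral ℤ w)
    (hz : z ∈ integralMultiples n) : w * z ∈ integralMultiples n :=
  (integralMultiples n).smul_mem (⟨w, hw⟩ : integralClosure ℤ ℂ) hz

theorem intCast_mem_integralMultiples {n : ℕ} (hn : n ≠ 0) {m : ℤ} :
    (m : ℂ) ∈ integralMultiples n ↔ (n : ℤ) ∣ m := by
  rw [mem_integralMultiples]
  constructor
  · rintro ⟨r, hr, h⟩
    have hn' : (n : ℂ) ≠ 0 := Nat.cast_ne_zero.2 hn
    have hr' : r = algebraMap ℚ ℂ ((m : ℚ) / n) := by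
      rw [eq_ratCast, Rat.cast_div, Rat.cast_intCast, Rat.cast_natCast, ← h,
        mul_div_cancel_right₀ _ hn']
    rw [hr', isIntegral_algebraMap_iff (algebraMap ℚ ℂ).injective,
      IsIntegrallyClosed.isIntegral_iff] at hr
    obtain ⟨k, hk⟩ := hr
    refine ⟨k, ?_⟩
    rw [← hk] at hr'
    have : (m : ℂ) = n * k := by
      rw [← h, hr']; simp [_root_.mul_comm]
    exact_mod_cast this
  · rintro ⟨k, rfl⟩
    exact ⟨k, isIntegral_algebraMap (x := k), by push_cast; ring⟩

theorem natCast_mem_integralMultiples {n : ℕ} (hn : n ≠ 0) {m : ℕ} :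
    (m : ℂ) ∈ integralMultiples n ↔ n ∣ m := by
  rw [← Int.natCast_dvd_natCast, ← intCast_mem_integralMultiples hn, Int.cast_natCast]

theorem isIntegral_natCast_complex (m : ℕ) : IsIntegral ℤ (m : ℂ) := by
  simpa using isIntegral_algebraMap (R := ℤ) (A := ℂ) (x := (m : ℤ))

/-- A sum of an invariant function over a set acted on by a `p`-group is congruent modulo `p`
to the sum over the fixed points. -/
theorem IsPGroup.sum_sub_sum_fixed_mem {A X : Type*} [Group A] [Fintype X]
    [MulAction A X] {p : ℕ} (hp : p.Prime) (hA : IsPGroup p A) (f : X → ℂ)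
    (hint : ∀ x, IsIntegral ℤ (f x)) (hinv : ∀ (a : A) x, f (a • x) = f x) :
    ∑ x, f x - ∑ x with ∀ a : A, a • x = x, f x ∈ integralMultiples p := by
  have := Fact.mk hp
  rw [← Finset.sum_fiberwise_of_maps_to (t := Finset.univ.image f) (g := f)
      (fun x _ => Finset.mem_image_of_mem _ (Finset.mem_univ x)),
    ← Finset.sum_fiberwise_of_maps_to (s := Finset.univ.filter fun x => ∀ a : A, a • x = x)
      (t := Finset.univ.image f) (g := f)
      (fun x _ => Finset.mem_image_of_mem _ (Finset.mem_univ x)), ← Finset.sum_sub_distrib]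
  refine Submodule.sum_mem _ fun v hv => ?_
  obtain ⟨x₀, -, rfl⟩ := Finset.mem_image.1 hv
  have hconst : ∀ s : Finset X, ∑ x ∈ s with f x = f x₀, f x =
      ((s.filter fun x => f x = f x₀).card : ℂ) * f x₀ := by
    intro s
    rw [Finset.sum_congr rfl fun x hx => (Finset.mem_filter.1 hx).2, Finset.sum_const,
      nsmul_eq_mul]
  rw [hconst, hconst, ← sub_mul, _root_.mul_comm]
  refine mul_mem_integralMultiples (hint x₀) ?_
  let Y : SubMulAction A X := ⟨{x | f x = f x₀}, fun a x hx => (hinv a x).trans hx⟩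
  have hmod := hA.card_modEq_card_fixedPoints Y
  have h1 : Nat.card Y = (Finset.univ.filter fun x => f x = f x₀).card := by
    rw [← Fintype.card_subtype, ← Nat.card_eq_fintype_card]
    rfl
  have h2 : Nat.card (MulAction.fixedPoints A Y) =
      ((Finset.univ.filter fun x => ∀ a : A, a • x = x).filter fun x => f x = f x₀).card := by
    rw [Finset.filter_filter, ← Fintype.card_subtype, ← Nat.card_eq_fintype_card]
    refine Nat.card_congr ⟨fun y => ⟨y.1.1, fun a => congrArg Subtype.val (y.2 a), y.1.2⟩,
      fun x => ⟨⟨x.1, x.2.2⟩, fun a => Subtype.ext (x.2.1 a)⟩, fun _ => rfl, fun _ => rfl⟩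
  rw [h1, h2] at hmod
  have := (intCast_mem_integralMultiples hp.ne_zero).2 (Nat.modEq_iff_dvd.1 hmod.symm)
  simpa using this

section FixedPoints

variable {G K A : Type} [Group G] [Fintype G] [Group K] [Fintype K] [Group A]
  {p : ℕ} {ρ : A →* MulAut G} {ι : K →* G}

theorem sum_sub_sum_comp_mem_integralMultiples (hp : p.Prime) (hA : IsPGroup p A)
    (hι : Function.Injective ι) (hfix : ∀ g, g ∈ ι.range ↔ ∀ a, ρ a g = g) (f : G → ℂ)
    (hint : ∀ g, IsIntegral ℤ (f g)) (hinv : ∀ a g, f (ρ a g) = f g) :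
    ∑ g, f g - ∑ k, f (ι k) ∈ integralMultiples p := by
  let _ : MulAction A G := MulAction.compHom G ρ
  have key := hA.sum_sub_sum_fixed_mem hp f hint hinv
  have h1 : ∑ k, f (ι k) = ∑ g with ∀ a : A, a • g = g, f g := by
    refine Finset.sum_bij (fun k _ => ι k) (fun k _ => ?_) (fun _ _ _ _ h => hι h)
      (fun g hg => ?_) (fun _ _ => rfl)
    · exact Finset.mem_filter.2 ⟨Finset.mem_univ _, (hfix _).1 ⟨k, rfl⟩⟩
    · obtain ⟨k, rfl⟩ := (hfix g).2 (Finset.mem_filter.1 hg).2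
      exact ⟨k, Finset.mem_univ _, rfl⟩
  rwa [h1]

theorem not_dvd_card_of_injective (hι : Function.Injective ι) (hpG : ¬ p ∣ Fintype.card G) :
    ¬ p ∣ Fintype.card K := fun h => hpG <| h.trans <| by
  simpa only [Nat.card_eq_fintype_card] using Subgroup.card_dvd_of_injective ι hι

theorem sum_eq_card_mul {χ σ : G → ℂ} (hσ : IsChar G σ) {m : ℕ} (h : innerChar G χ σ = m) :
    ∑ g, χ g * σ g⁻¹ = (Fintype.card G * m : ℕ) := by
  rw [← card_mul_innerChar χ hσ, h, Nat.cast_mul]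

/-- Distinct invariant irreducible characters have no common irreducible constituent with
multiplicities prime to `p` on restriction to the fixed points. -/
theorem IsIrrChar.dvd_mul_of_ne (hp : p.Prime) (hA : IsPGroup p A) (hpG : ¬ p ∣ Fintype.card G)
    (hι : Function.Injective ι) (hfix : ∀ g, g ∈ ι.range ↔ ∀ a, ρ a g = g)
    {ψ ψ' : G → ℂ} (hψ : IsIrrChar G ψ) (hψ' : IsIrrChar G ψ') (hne : ψ ≠ ψ')
    (hψA : ∀ a g, ψ (ρ a g) = ψ g) (hψA' : ∀ a g, ψ' (ρ a g) = ψ' g)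
    {σ : K → ℂ} (hσ : IsIrrChar K σ) {m m' : ℕ} (hm : innerChar K (fun k => ψ (ι k)) σ = m)
    (hm' : innerChar K (fun k => ψ' (ι k)) σ = m') : p ∣ m * m' := by
  have hK := not_dvd_card_of_injective hι hpG
  have hcard : (Fintype.card K : ℂ) ≠ 0 := Nat.cast_ne_zero.2 Fintype.card_ne_zero
  set S : ℂ := ∑ x, σ x⁻¹ * ∑ k, ψ (ι k) * ψ' (ι (k⁻¹ * x)) with hS
  have hmem : S ∈ integralMultiples p := by
    refine Submodule.sum_mem _ fun x _ => mul_mem_integralMultiples (hσ.1.isIntegral _) ?_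
    have key := sum_sub_sum_comp_mem_integralMultiples hp hA hι hfix
      (fun g => ψ g * ψ' (g⁻¹ * ι x))
      (fun g => (hψ.1.isIntegral _).mul (hψ'.1.isIntegral _)) (fun a g => by
        have h1 : (ρ a g)⁻¹ * ι x = ρ a (g⁻¹ * ι x) := by
          rw [map_mul, map_inv, (hfix (ι x)).1 ⟨x, rfl⟩ a]
        rw [h1, hψA, hψA'])
    rw [hψ.sum_mul_inv_mul hψ' hne, zero_sub, neg_mem_iff] at key
    simpa using key
  have hS2 : ∀ d, S = ∑ k, ∑ y, ψ (ι k) * ψ' (ι y) * σ (y⁻¹ * (d * k⁻¹ * d⁻¹)) := by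
    intro d
    simp only [hS, Finset.mul_sum]
    rw [Finset.sum_comm]
    refine Fintype.sum_equiv (MulAut.conj d⁻¹).toEquiv _ _ fun k => ?_
    refine Fintype.sum_equiv (Equiv.mulLeft k⁻¹) _ _ fun x => ?_
    have h1 : ψ (ι (d⁻¹ * k * d)) = ψ (ι k) := by
      rw [map_mul, hψ.1.mul_comm, ← map_mul, mul_inv_cancel_left]
    have h2 : (k⁻¹ * x)⁻¹ * (d * (d⁻¹ * k * d)⁻¹ * d⁻¹) = x⁻¹ := by group
    simp only [MulEquiv.toEquiv_eq_coe, MulEquiv.coe_toEquiv, MulAut.conj_apply, inv_inv,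
      Equiv.coe_mulLeft]
    rw [h1, h2]
    ring
  have hS3 : σ 1 * (Fintype.card K * S) = Fintype.card K *
      (((Fintype.card K * m : ℕ) : ℂ) * (Fintype.card K * m' : ℕ)) := by
    rw [← sum_eq_card_mul hσ.1 hm, ← sum_eq_card_mul hσ.1 hm', ← nsmul_eq_mul,
      ← Finset.card_univ, ← Finset.sum_const, Finset.sum_congr rfl fun d _ => hS2 d,
      Finset.sum_comm, Finset.sum_mul_sum, Finset.mul_sum, Finset.mul_sum]
    refine Finset.sum_congr rfl fun k _ => ?_
    rw [Finset.sum_comm, Finset.mul_sum, Finset.mul_sum]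
    refine Finset.sum_congr rfl fun y _ => ?_
    rw [← Finset.mul_sum]
    rw [Finset.card_univ]
    linear_combination (ψ (ι k) * ψ' (ι y)) * hσ.sum_mul_conj y⁻¹ k⁻¹
  have hS4 : σ 1 * S = ((Fintype.card K * m * (Fintype.card K * m') : ℕ) : ℂ) := by
    apply mul_left_cancel₀ hcard
    rw [Nat.cast_mul, ← hS3]
    ring
  have h5 := mul_mem_integralMultiples (hσ.1.isIntegral 1) hmem
  rw [hS4, natCast_mem_integralMultiples hp.ne_zero, hp.dvd_mul, hp.dvd_mul, hp.dvd_mul] at h5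
  rw [hp.dvd_mul]
  tauto

/-- The restriction of an invariant irreducible character to the fixed points has at most one
irreducible constituent with multiplicity prime to `p`. -/
theorem IsIrrChar.dvd_mul_of_ne_constituents (hp : p.Prime) (hA : IsPGroup p A)
    (hpG : ¬ p ∣ Fintype.card G)
    (hι : Function.Injective ι) (hfix : ∀ g, g ∈ ι.range ↔ ∀ a, ρ a g = g)
    {θ : G → ℂ} (hθ : IsIrrChar G θ) (hθA : ∀ a g, θ (ρ a g) = θ g)
    {σ τ : K → ℂ} (hσ : IsIrrChar K σ) (hτ : IsIrrChar K τ) (hne : σ ≠ τ) {m m' : ℕ}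
    (hm : innerChar K (fun k => θ (ι k)) σ = m)
    (hm' : innerChar K (fun k => θ (ι k)) τ = m') : p ∣ m * m' := by
  have hK := not_dvd_card_of_injective hι hpG
  set T : K → K → ℂ := fun x y => ∑ g, θ (ι x * (g * ι y * g⁻¹)) with hT
  set U : K → K → ℂ := fun x y => ∑ c, θ (ι x * (ι c * ι y * (ι c)⁻¹)) with hU
  have hmem : ∀ x y, T x y - U x y ∈ integralMultiples p := fun x y =>
    sum_sub_sum_comp_mem_integralMultiples hp hA hι hfix (fun g => θ (ι x * (g * ι y * g⁻¹)))
      (fun g => hθ.1.isIntegral _) (fun a g => by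
        have h1 : ι x * (ρ a g * ι y * (ρ a g)⁻¹) = ρ a (ι x * (g * ι y * g⁻¹)) := by
          simp only [map_mul, map_inv, (hfix (ι x)).1 ⟨x, rfl⟩ a, (hfix (ι y)).1 ⟨y, rfl⟩ a]
        rw [h1, hθA])
  have hU0 : ∑ x, ∑ y, σ x⁻¹ * τ y⁻¹ * U x y = 0 := by
    have h0 : ∑ x, ∑ y, σ x⁻¹ * τ y⁻¹ * θ (ι (x * y)) = 0 := by
      have h1 : ∑ x, ∑ y, σ x⁻¹ * τ y⁻¹ * θ (ι (x * y)) =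
          ∑ x, ∑ z, σ x * τ (x⁻¹ * z⁻¹) * θ (ι z) := by
        refine Fintype.sum_equiv (Equiv.inv K) _ _ fun x => ?_
        refine Fintype.sum_equiv (Equiv.mulLeft x) _ _ fun y => ?_
        have h2 : τ (x * (y⁻¹ * x⁻¹)) = τ y⁻¹ := by
          rw [hτ.1.mul_comm, mul_assoc, inv_mul_cancel, mul_one]
        simp [h2]
      rw [h1, Finset.sum_comm]
      refine Finset.sum_eq_zero fun z _ => ?_
      rw [← Finset.sum_mul, hσ.sum_mul_inv_mul hτ hne, zero_mul]
    simp only [hU, Finset.mul_sum]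
    have h1 : ∀ c, ∑ x, ∑ y, σ x⁻¹ * τ y⁻¹ * θ (ι x * (ι c * ι y * (ι c)⁻¹)) = 0 := by
      intro c
      rw [← h0]
      refine Finset.sum_congr rfl fun x _ => ?_
      refine Fintype.sum_equiv (MulAut.conj c).toEquiv _ _ fun y => ?_
      have h2 : τ (c * y⁻¹ * c⁻¹) = τ y⁻¹ := by rw [hτ.1.mul_comm, inv_mul_cancel_left]
      have h3 : (c * y * c⁻¹)⁻¹ = c * y⁻¹ * c⁻¹ := by group
      simp only [MulEquiv.toEquiv_eq_coe, MulEquiv.coe_toEquiv, MulAut.conj_apply]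
      rw [h3, h2]
      simp only [map_mul, map_inv]
    have h4 : ∀ x, ∑ y, ∑ c, σ x⁻¹ * τ y⁻¹ * θ (ι x * (ι c * ι y * (ι c)⁻¹)) =
        ∑ c, ∑ y, σ x⁻¹ * τ y⁻¹ * θ (ι x * (ι c * ι y * (ι c)⁻¹)) :=
      fun x => Finset.sum_comm
    simp only [h4]
    rw [Finset.sum_comm]
    exact Finset.sum_eq_zero fun c _ => h1 c
  have h5 : ∑ x, ∑ y, σ x⁻¹ * τ y⁻¹ * T x y ∈ integralMultiples p := by
    rw [← sub_zero (∑ x, _), ← hU0, ← Finset.sum_sub_distrib]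
    refine Submodule.sum_mem _ fun x _ => ?_
    rw [← Finset.sum_sub_distrib]
    refine Submodule.sum_mem _ fun y _ => ?_
    rw [← mul_sub]
    exact mul_mem_integralMultiples ((hσ.1.isIntegral _).mul (hτ.1.isIntegral _)) (hmem x y)
  have h6 : θ 1 * ∑ x, ∑ y, σ x⁻¹ * τ y⁻¹ * T x y =
      ((Fintype.card G * (Fintype.card K * m * (Fintype.card K * m')) : ℕ) : ℂ) := by
    rw [Nat.cast_mul, Nat.cast_mul (Fintype.card K * m), ← sum_eq_card_mul hσ.1 hm,
      ← sum_eq_card_mul hτ.1 hm', Finset.sum_mul_sum, Finset.mul_sum, Finset.mul_sum]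
    refine Finset.sum_congr rfl fun x _ => ?_
    rw [Finset.mul_sum, Finset.mul_sum]
    refine Finset.sum_congr rfl fun y _ => ?_
    linear_combination (σ x⁻¹ * τ y⁻¹) * hθ.sum_mul_conj (ι x) (ι y)
  have h7 := mul_mem_integralMultiples (hθ.1.isIntegral 1) h5
  rw [h6, natCast_mem_integralMultiples hp.ne_zero, hp.dvd_mul, hp.dvd_mul, hp.dvd_mul,
    hp.dvd_mul] at h7
  rw [hp.dvd_mul]
  tauto

/-- The restriction of an invariant irreducible character to the fixed points has an
irreducible constituent with multiplicity prime to `p`. -/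
theorem IsIrrChar.exists_constituent_not_dvd (hp : p.Prime) (hA : IsPGroup p A)
    (hpG : ¬ p ∣ Fintype.card G)
    (hι : Function.Injective ι) (hfix : ∀ g, g ∈ ι.range ↔ ∀ a, ρ a g = g)
    {ψ : G → ℂ} (hψ : IsIrrChar G ψ) (hψA : ∀ a g, ψ (ρ a g) = ψ g) :
    ∃ σ : K → ℂ, IsIrrChar K σ ∧ ∃ m : ℕ, innerChar K (fun k => ψ (ι k)) σ = m ∧ ¬ p ∣ m := by
  by_contra! hcon
  have hψK : IsChar K fun k => ψ (ι k) := hψ.1.comp ι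
  have key := sum_sub_sum_comp_mem_integralMultiples hp hA hι hfix
    (fun g => ψ g * ψ g⁻¹) (fun g => (hψ.1.isIntegral _).mul (hψ.1.isIntegral _))
    (fun a g => by rw [← map_inv, hψA, hψA])
  have h1 : ∑ k, ψ (ι k) * ψ (ι k)⁻¹ ∈ integralMultiples p := by
    obtain ⟨S, hS, hsum⟩ := hψK.exists_eq_sum
    have h2 : ∑ k, ψ (ι k) * ψ (ι k)⁻¹ =
        ∑ σ ∈ S, innerChar K (fun k => ψ (ι k)) σ * ∑ k, ψ (ι k)⁻¹ * σ k := by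
      simp only [Finset.mul_sum]
      rw [Finset.sum_comm]
      refine Finset.sum_congr rfl fun k _ => ?_
      have h3 : ψ (ι k) = ∑ σ ∈ S, innerChar K (fun k => ψ (ι k)) σ * σ k := congrFun hsum k
      conv_lhs => rw [h3]
      rw [Finset.sum_mul]
      exact Finset.sum_congr rfl fun σ _ => by ring
    rw [h2]
    refine Submodule.sum_mem _ fun σ hσ => ?_
    have hσi := ((hS σ).1 hσ).1
    obtain ⟨m, hm⟩ := innerChar_eq_natCast hψK hσi.1
    rw [hm, _root_.mul_comm]
    refine mul_mem_integralMultiples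
      (IsIntegral.sum _ fun k _ => (hψ.1.isIntegral _).mul (hσi.1.isIntegral _)) ?_
    exact (natCast_mem_integralMultiples hp.ne_zero).2 (hcon σ hσi m hm)
  have h2 : ∑ g, ψ g * ψ g⁻¹ = (Fintype.card G : ℂ) := by
    rw [← card_mul_innerChar ψ hψ.1, hψ.2, mul_one]
  have h3 := add_mem key h1
  rw [sub_add_cancel, h2, natCast_mem_integralMultiples hp.ne_zero] at h3
  exact hpG h3

theorem innerChar_comp_equiv {G : Type*} [Group G] [Fintype G] (e : G ≃* G) (χ ψ : G → ℂ) :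
    innerChar G (fun g => χ (e g)) (fun g => ψ (e g)) = innerChar G χ ψ := by
  simp only [innerChar]
  congr 1
  exact Fintype.sum_equiv e.toEquiv _ _ fun _ => rfl

theorem IsIrrChar.comp_equiv {χ : G → ℂ} (h : IsIrrChar G χ) (e : G ≃* G) :
    IsIrrChar G fun g => χ (e g) :=
  ⟨h.1.comp e.toMonoidHom, (innerChar_comp_equiv e χ χ).trans h.2⟩

/-- Multiplicities of an invariant character `χ` in the restriction to the fixed points are
computed modulo `p` by a single invariant irreducible constituent. -/
theorem IsChar.innerChar_sub_mul_mem (hp : p.Prime) (hA : IsPGroup p A)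
    (hpG : ¬ p ∣ Fintype.card G)
    (hι : Function.Injective ι) (hfix : ∀ g, g ∈ ι.range ↔ ∀ a, ρ a g = g)
    {χ φ : G → ℂ} (hχ : IsChar G χ) (hχA : ∀ a g, χ (ρ a g) = χ g)
    (hφ : IsIrrChar G φ) (hφA : ∀ a g, φ (ρ a g) = φ g)
    {σ : K → ℂ} (hσ : IsIrrChar K σ) {m : ℕ} (hm : innerChar K (fun k => φ (ι k)) σ = m)
    (hpm : ¬ p ∣ m) :
    innerChar K (fun k => χ (ι k)) σ - innerChar G χ φ * m ∈ integralMultiples p := by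
  obtain ⟨S, hS, hsum⟩ := hχ.exists_eq_sum
  have hχinv : ∀ a, (fun g => χ (ρ a g)) = χ := fun a => funext (hχA a)
  let _ : MulAction A S :=
    { smul := fun a ψ => ⟨fun g => ψ.1 (ρ a⁻¹ g), by
        have h := (hS _).1 ψ.2
        refine (hS _).2 ⟨h.1.comp_equiv (ρ a⁻¹), ?_⟩
        rw [← hχinv a⁻¹, innerChar_comp_equiv]
        exact h.2⟩
      one_smul := fun ψ => Subtype.ext <| funext fun g => by
        change ψ.1 (ρ 1⁻¹ g) = ψ.1 g
        simp
      mul_smul := fun a b ψ => Subtype.ext <| funext fun g => by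
        change ψ.1 (ρ (a * b)⁻¹ g) = ψ.1 (ρ b⁻¹ (ρ a⁻¹ g))
        simp }
  have hsmul : ∀ (a : A) (ψ : S) g, (a • ψ).1 g = ψ.1 (ρ a⁻¹ g) := fun _ _ _ => rfl
  have hfixed : ∀ ψ : S, (∀ a : A, a • ψ = ψ) ↔ ∀ a g, ψ.1 (ρ a g) = ψ.1 g := by
    intro ψ
    constructor
    · intro h a g
      have := hsmul a⁻¹ ψ g
      rw [h, inv_inv] at this
      exact this.symm
    · exact fun h a => Subtype.ext (funext fun g => h a⁻¹ g)
  let f : S → ℂ := fun ψ => innerChar G χ ψ.1 * innerChar K (fun k => ψ.1 (ι k)) σ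
  have hf : ∀ ψ : S, ∃ n : ℕ, f ψ = n := by
    intro ψ
    have h := (hS _).1 ψ.2
    obtain ⟨n, hn⟩ := innerChar_eq_natCast hχ h.1.1
    obtain ⟨n', hn'⟩ := innerChar_eq_natCast (h.1.1.comp ι) hσ.1
    exact ⟨n * n', by simp only [f, hn, hn', Nat.cast_mul]⟩
  have hrestr : innerChar K (fun k => χ (ι k)) σ = ∑ ψ : S, f ψ := by
    have h1 : (fun k => χ (ι k)) = fun k => ∑ ψ ∈ S, innerChar G χ ψ * ψ (ι k) :=
      funext fun k => congrFun hsum (ι k)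
    rw [h1, innerChar_sum_mul S (fun ψ => innerChar G χ ψ) (fun ψ k => ψ (ι k)),
      ← Finset.sum_coe_sort S]
  have key := hA.sum_sub_sum_fixed_mem hp f
    (fun ψ => by obtain ⟨n, hn⟩ := hf ψ; rw [hn]; exact isIntegral_natCast_complex n)
    (fun a ψ => by
      have h1 : innerChar G χ (a • ψ).1 = innerChar G χ ψ.1 := by
        conv_lhs => rw [← hχinv a⁻¹]
        exact innerChar_comp_equiv _ _ _
      have h2 : (fun k => (a • ψ).1 (ι k)) = fun k => ψ.1 (ι k) := funext fun k => by
        rw [hsmul, (hfix (ι k)).1 ⟨k, rfl⟩]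
      simp only [f, h1, h2])
  have hother : ∀ ψ : S, (∀ a : A, a • ψ = ψ) → ψ.1 ≠ φ → f ψ ∈ integralMultiples p := by
    intro ψ hψ hne
    have h := (hS _).1 ψ.2
    obtain ⟨n, hn⟩ := innerChar_eq_natCast hχ h.1.1
    obtain ⟨n', hn'⟩ := innerChar_eq_natCast (h.1.1.comp ι) hσ.1
    have hd := IsIrrChar.dvd_mul_of_ne hp hA hpG hι hfix h.1 hφ hne ((hfixed ψ).1 hψ) hφA hσ
      hn' hm
    have hd' : p ∣ n' := (hp.dvd_mul.1 hd).resolve_right hpm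
    simp only [f]
    rw [hn, hn']
    exact mul_mem_integralMultiples (isIntegral_natCast_complex n)
      ((natCast_mem_integralMultiples hp.ne_zero).2 hd')
  have hfix_sum : ∑ ψ : S with ∀ a : A, a • ψ = ψ, f ψ - innerChar G χ φ * m ∈
      integralMultiples p := by
    by_cases hφS : φ ∈ S
    · have hmemf : (⟨φ, hφS⟩ : S) ∈ Finset.univ.filter fun ψ : S => ∀ a : A, a • ψ = ψ :=
        Finset.mem_filter.2 ⟨Finset.mem_univ _, (hfixed _).2 hφA⟩
      rw [← Finset.add_sum_erase _ _ hmemf]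
      have h1 : f ⟨φ, hφS⟩ = innerChar G χ φ * m := by simp only [f, hm]
      rw [h1, add_sub_cancel_left]
      refine Submodule.sum_mem _ fun ψ hψ => ?_
      rw [Finset.mem_erase, Finset.mem_filter] at hψ
      exact hother ψ hψ.2.2 fun h => hψ.1 (Subtype.ext h)
    · have h0 : innerChar G χ φ = 0 := by
        by_contra h
        exact hφS ((hS φ).2 ⟨hφ, h⟩)
      rw [h0, zero_mul, sub_zero]
      refine Submodule.sum_mem _ fun ψ hψ => hother ψ (Finset.mem_filter.1 hψ).2 ?_
      rintro h
      exact hφS (h ▸ ψ.2)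
  rw [hrestr]
  have := add_mem key hfix_sum
  rwa [sub_add_sub_cancel] at this

end FixedPoints

theorem stmt_14 {G A : Type} [Group G] [Fintype G] [Group A] [Fintype A]
    (p : ℕ) (hp : p.Prime) (hA : IsPGroup p A) (hpG : ¬ p ∣ Fintype.card G)
    (ρ : A →* MulAut G)
    (C : Subgroup G) (hC : ∀ g : G, g ∈ C ↔ ∀ a : A, ρ a g = g)
    (H : Subgroup G) (hCH : C ≤ H) (hHinv : ∀ a : A, ∀ g ∈ H, ρ a g ∈ H)
    (θ : G → ℂ) (hθ : IsIrrChar G θ) (hθA : ∀ a : A, ∀ g : G, θ (ρ a g) = θ g)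
    -- `φ = f_A(θ)`: the unique `A`-invariant irreducible constituent of `θ_H`
    -- with multiplicity not divisible by `p`
    (φ : ↥H → ℂ) (hφ : IsIrrChar ↥H φ)
    (hφA : ∀ a : A, ∀ h : ↥H, φ ⟨ρ a ↑h, hHinv a ↑h h.2⟩ = φ h)
    (hφm : ∃ m : ℕ, innerChar ↥H (fun h => θ ↑h) φ = m ∧ ¬ p ∣ m)
    -- `τ = θ*`: the `A`-Glauberman correspondent of `θ`, i.e. the unique irreducible
    -- constituent of `θ_C` with multiplicity not divisible by `p`
    (τ : ↥C → ℂ) (hτ : IsIrrChar ↥C τ)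
    (hτm : ∃ m : ℕ, innerChar ↥C (fun c => θ ↑c) τ = m ∧ ¬ p ∣ m) :
    ∀ a b c : ℕ,
      innerChar ↥C (fun g => θ ↑g) τ = a →
      innerChar ↥H (fun h => θ ↑h) φ = b →
      innerChar ↥C (fun g => φ ⟨↑g, hCH g.2⟩) τ = c →
      (a : ZMod p) = (b : ZMod p) * (c : ZMod p) := by
  intro a b c ha hb hc
  let ρH : A →* MulAut H :=
    { toFun := fun x =>
        { toFun := fun h => ⟨ρ x h, hHinv x h h.2⟩
          invFun := fun h => ⟨ρ x⁻¹ h, hHinv x⁻¹ h h.2⟩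
          left_inv := fun h => Subtype.ext (by simp)
          right_inv := fun h => Subtype.ext (by simp)
          map_mul' := fun h k => Subtype.ext (by simp) }
      map_one' := MulEquiv.ext fun h => Subtype.ext (by simp)
      map_mul' := fun x y => MulEquiv.ext fun h => Subtype.ext (by simp) }
  have hρH : ∀ x h, ρH x h = ⟨ρ x h, hHinv x h h.2⟩ := fun _ _ => rfl
  have hpH : ¬ p ∣ Fintype.card H :=
    not_dvd_card_of_injective (ι := H.subtype) H.subtype_injective hpG
  have hιH : Function.Injective (Subgroup.inclusion hCH) := Subgroup.inclusion_injective hCH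
  have hfixG : ∀ g, g ∈ C.subtype.range ↔ ∀ x, ρ x g = g := by
    intro g
    rw [Subgroup.range_subtype, hC]
  have hfixH : ∀ h, h ∈ (Subgroup.inclusion hCH).range ↔ ∀ x, ρH x h = h := by
    intro h
    rw [Subgroup.inclusion_range, Subgroup.mem_subgroupOf, hC]
    simp only [hρH, Subtype.ext_iff]
  have hθH : IsChar H fun h => θ h := hθ.1.comp H.subtype
  have hθC : IsChar C fun g => θ g := hθ.1.comp C.subtype
  have hcongr : ∀ {σ : C → ℂ}, IsIrrChar C σ → ∀ {m : ℕ},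
      innerChar C (fun k => φ (Subgroup.inclusion hCH k)) σ = m → ¬ p ∣ m →
      ∀ {n : ℕ}, innerChar C (fun g => θ g) σ = n → (p : ℤ) ∣ n - b * m := by
    intro σ hσ m hm hpm n hn
    have h := IsChar.innerChar_sub_mul_mem (ρ := ρH) hp hA hpH hιH hfixH hθH
      (fun x h => hθA x h) hφ hφA hσ hm hpm
    rw [← intCast_mem_integralMultiples hp.ne_zero]
    rw [hb] at h
    have h' : innerChar C (fun k => θ (Subgroup.inclusion hCH k : H)) σ = n := hn
    rw [h'] at h
    exact_mod_cast h
  have hpb : ¬ p ∣ b := by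
    obtain ⟨m, hm, hpm⟩ := hφm
    rwa [Nat.cast_injective (hb.symm.trans hm)]
  have hpa : ¬ p ∣ a := by
    obtain ⟨m, hm, hpm⟩ := hτm
    rwa [Nat.cast_injective (ha.symm.trans hm)]
  obtain ⟨σ, hσ, m, hm, hpm⟩ :=
    hφ.exists_constituent_not_dvd (ρ := ρH) hp hA hpH hιH hfixH hφA
  obtain ⟨n, hn⟩ := innerChar_eq_natCast hθC hσ.1
  have hdvd := hcongr hσ hm hpm hn
  have hpn : ¬ p ∣ n := by
    intro h
    have h1 : (p : ℤ) ∣ (b * m : ℕ) := by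
      have := (dvd_sub (Int.natCast_dvd_natCast.2 h) hdvd)
      simpa using this
    rcases hp.dvd_mul.1 (Int.natCast_dvd_natCast.1 h1) with h | h
    · exact hpb h
    · exact hpm h
  have hστ : σ = τ := by
    by_contra hne
    have h := hθ.dvd_mul_of_ne_constituents (ι := C.subtype) hp hA hpG C.subtype_injective hfixG
      hθA hσ hτ hne hn ha
    exact (hp.dvd_mul.1 h).elim hpn hpa
  subst hστ
  obtain rfl : n = a := Nat.cast_injective (hn.symm.trans ha)
  obtain rfl : m = c := Nat.cast_injective (hm.symm.trans hc)
  have h := (ZMod.intCast_zmod_eq_zero_iff_dvd _ p).2 hdvd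
  push_cast at h
  exact sub_eq_zero.1 h
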